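/- For every n ≥ 0, the topological standard n-simplex Δⁿ, stratified over the linear poset [n] = {0 < 1 < … < n} by σ(x) = max{i : x_i > 0}, carries the final topology with respect to its exit paths: a subset U ⊆ Δⁿ is open if and only if γ⁻¹(U) is open in [0,1] for every exit path γ : [0,1] → Δⁿ. Moreover, every convergent sequence in Δⁿ admits a subsequence (x_i)_{i≥1} with limit x̄ such that there exists an exit path γ : [0,1] → Δⁿ with γ(0) = x̄ and γ(2^{-i}) = x_i for all i ≥ 1. -/

import Mathlib

open Set unitInterval

noncomputable section

/-! ### Stratified spaces over a poset -/

/-- Continuity into the Alexandrov topology on a preordered set: preimages of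
upper sets are open. -/
def AlexContinuous {P : Type*} [Preorder P] {X : Type*} [TopologicalSpace X] (s : X → P) : Prop :=
  ∀ U : Set P, IsUpperSet U → IsOpen (s ⁻¹' U)

lemma stdSimplex.exists_pos' {n : ℕ} (x : stdSimplex ℝ (Fin (n + 1))) :
    ∃ i, 0 < (x : Fin (n + 1) → ℝ) i := by
  by_contra h
  push_neg at h
  have h1 : ∑ i, (x : Fin (n + 1) → ℝ) i = 1 := x.2.2
  have h2 : ∑ i, (x : Fin (n + 1) → ℝ) i ≤ 0 := Finset.sum_nonpos fun i _ => h i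
  linarith

/-- The largest index with positive barycentric coordinate. -/
def maxSupp {n : ℕ} (x : stdSimplex ℝ (Fin (n + 1))) : Fin (n + 1) :=
  (Finset.univ.filter fun i => 0 < (x : Fin (n + 1) → ℝ) i).max' (by
    obtain ⟨i, hi⟩ := stdSimplex.exists_pos' x
    exact ⟨i, Finset.mem_filter.2 ⟨Finset.mem_univ i, hi⟩⟩)

/-- The stratification of the realized stratified simplex `|Δ^J|` of a flag `J`. -/
def flagStrat {P : Type*} {n : ℕ} (J : Fin (n + 1) → P) (x : stdSimplex ℝ (Fin (n + 1))) : P :=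
  J (maxSupp x)

/-- The `k`-th horn of the standard `n`-simplex, as a subset of the simplex. -/
def hornSet (n : ℕ) (k : Fin (n + 1)) : Set (stdSimplex ℝ (Fin (n + 1))) :=
  {x | ∃ i, i ≠ k ∧ (x : Fin (n + 1) → ℝ) i = 0}

/-- `X` (stratified by `s`) has the horn filling property with respect to the
realized stratified horn inclusion `|Λ^J_k| ↪ |Δ^J|`. -/
def HornFilling {P : Type*} {X : Type*} [TopologicalSpace X] (s : X → P) {n : ℕ}
    (J : Fin (n + 1) → P) (k : Fin (n + 1)) : Prop :=
  ∀ f : hornSet n k → X, Continuous f →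
    (∀ y : hornSet n k, s (f y) = flagStrat J y.1) →
    ∃ g : stdSimplex ℝ (Fin (n + 1)) → X, Continuous g ∧
      (∀ x, s (g x) = flagStrat J x) ∧ ∀ y : hornSet n k, g y.1 = f y

/-- `(J, k)` is an inner horn datum. -/
def IsInner (n : ℕ) (k : Fin (n + 1)) : Prop := 0 < (k : ℕ) ∧ (k : ℕ) < n

/-- `(J, k)` is an admissible horn datum. -/
def IsAdmissible {P : Type*} {n : ℕ} (J : Fin (n + 1) → P) (k : Fin (n + 1)) : Prop :=
  IsInner n k ∨
    ((k : ℕ) = 0 ∧ ∃ h : 0 < n, J ⟨0, Nat.succ_pos n⟩ = J ⟨1, Nat.succ_lt_succ h⟩) ∨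
    ((k : ℕ) = n ∧ ∃ _h : 0 < n, J ⟨n - 1, by omega⟩ = J ⟨n, Nat.lt_succ_self n⟩)

/-- A stratified space is categorically fibrant if it has the horn filling property
with respect to all inner stratified horn inclusions. -/
def CatFibrant {P : Type*} [Preorder P] {X : Type*} [TopologicalSpace X] (s : X → P) : Prop :=
  ∀ (n : ℕ) (J : Fin (n + 1) → P), Monotone J → ∀ k : Fin (n + 1), IsInner n k → HornFilling s J k

/-- A stratified space is diagrammatically fibrant if it has the horn filling property
with respect to all admissible stratified horn inclusions. -/
def DiagFibrant {P : Type*} [Preorder P] {X : Type*} [TopologicalSpace X] (s : X → P) : Prop :=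
  ∀ (n : ℕ) (J : Fin (n + 1) → P), Monotone J → ∀ k : Fin (n + 1), IsAdmissible J k →
    HornFilling s J k

/-! ### Exit paths and refinedness -/

/-- An exit path: `s ∘ γ` is constant on `(0, 1]` and does not decrease from `γ 0`. -/
def IsExitPath {P : Type*} [Preorder P] {X : Type*} [TopologicalSpace X]
    (s : X → P) (γ : C(I, X)) : Prop :=
  (∀ t t' : I, t ≠ 0 → t' ≠ 0 → s (γ t) = s (γ t')) ∧ ∀ t : I, s (γ 0) ≤ s (γ t)

/-- One step in a chain of exit paths. -/
def ExitStep {P : Type*} [Preorder P] {X : Type*} [TopologicalSpace X] (s : X → P)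
    (x y : X) : Prop :=
  ∃ γ : C(I, X), IsExitPath s γ ∧ γ 0 = x ∧ γ 1 = y

/-- A stratified space is refined if its stratification is surjective and the order
relation is exactly detected by finite chains of exit paths. -/
def IsRefined {P : Type*} [Preorder P] {X : Type*} [TopologicalSpace X] (s : X → P) : Prop :=
  Function.Surjective s ∧ ∀ x y : X, s x ≤ s y ↔ Relation.ReflTransGen (ExitStep s) x y

/-- The frontier relation: the `p`-stratum meets the closure of the `q`-stratum. -/
def FrontierRel {P : Type*} {X : Type*} [TopologicalSpace X] (s : X → P) (p q : P) : Prop :=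
  (s ⁻¹' {p} ∩ closure (s ⁻¹' {q})).Nonempty

/-- Weakly frontier stratified. -/
def WeaklyFrontierStratified {P : Type*} [Preorder P] {X : Type*} [TopologicalSpace X]
    (s : X → P) : Prop :=
  Function.Surjective s ∧ ∀ p q : P, p ≤ q ↔ Relation.ReflTransGen (FrontierRel s) p q

/-- Frontier stratified. -/
def FrontierStratified {P : Type*} [Preorder P] {X : Type*} [TopologicalSpace X]
    (s : X → P) : Prop :=
  WeaklyFrontierStratified s ∧ ∀ p q : P, FrontierRel s p q → s ⁻¹' {p} ⊆ closure (s ⁻¹' {q})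

/-! ### Homotopy links -/

lemma I_one_ne_zero : (1 : I) ≠ 0 := fun h => one_ne_zero (α := ℝ) (congrArg Subtype.val h)

/-- The pairwise homotopy link of the pair of strata `p`, `q`. -/
abbrev PairHolink {P : Type*} {X : Type*} [TopologicalSpace X] (s : X → P) (p q : P) :=
  {γ : C(I, X) // s (γ 0) = p ∧ ∀ t : I, t ≠ 0 → s (γ t) = q}

/-- Starting point evaluation on the pairwise homotopy link. -/
def pairHolinkEv0 {P : Type*} {X : Type*} [TopologicalSpace X] (s : X → P) (p q : P)
    (γ : PairHolink s p q) : {x : X // s x = p} :=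
  ⟨γ.1 0, γ.2.1⟩

/-- A Serre fibration: a map with the homotopy lifting property with respect to all
Euclidean disks. -/
def IsSerreFibration {E B : Type*} [TopologicalSpace E] [TopologicalSpace B] (π : E → B) : Prop :=
  ∀ (n : ℕ)
    (H : ↥(Metric.closedBall (0 : EuclideanSpace ℝ (Fin n)) 1) × I → B)
    (h₀ : ↥(Metric.closedBall (0 : EuclideanSpace ℝ (Fin n)) 1) → E),
    Continuous H → Continuous h₀ → (∀ d, π (h₀ d) = H (d, 0)) →
    ∃ G : ↥(Metric.closedBall (0 : EuclideanSpace ℝ (Fin n)) 1) × I → E,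
      Continuous G ∧ (∀ d, G (d, 0) = h₀ d) ∧ ∀ z, π (G z) = H z

/-- The stratified homotopy link of the stratum `p`: exit paths starting in the
`p`-stratum and immediately leaving it. -/
abbrev StratHolink {P : Type*} [Preorder P] {X : Type*} [TopologicalSpace X]
    (s : X → P) (p : P) :=
  {γ : C(I, X) // s (γ 0) = p ∧ (∀ t : I, t ≠ 0 → p < s (γ t)) ∧
    ∀ t t' : I, t ≠ 0 → t' ≠ 0 → s (γ t) = s (γ t')}

/-- The stratification of the stratified homotopy link over `P_{>p}`. -/
def stratHolinkStrat {P : Type*} [Preorder P] {X : Type*} [TopologicalSpace X]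
    (s : X → P) (p : P) (γ : StratHolink s p) : {q : P // p < q} :=
  ⟨s (γ.1 1), γ.2.2.1 1 I_one_ne_zero⟩

/-- Endpoint evaluation on the stratified homotopy link. -/
def stratHolinkEv1 {P : Type*} [Preorder P] {X : Type*} [TopologicalSpace X]
    (s : X → P) (p : P) (γ : StratHolink s p) : {x : X // p < s x} :=
  ⟨γ.1 1, γ.2.2.1 1 I_one_ne_zero⟩

/-- The generalized homotopy link of a (regular) flag `Iflag`: the space of stratified
maps `|Δ^Iflag| → X`, topologized via the compact-open topology. -/
abbrev Holink {P : Type*} {X : Type*} [TopologicalSpace X] (s : X → P) {m : ℕ}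
    (Iflag : Fin (m + 1) → P) :=
  {f : C(stdSimplex ℝ (Fin (m + 1)), X) // ∀ x, s (f x) = flagStrat Iflag x}

/-! ### Weak homotopy equivalences -/

/-- The boundary of the `n`-cube. -/
def cubeBoundary (n : ℕ) : Set (Fin n → I) := {y | ∃ i, y i = 0 ∨ y i = 1}

/-- Generalized loops: maps of the `n`-cube collapsing the boundary to the basepoint. -/
abbrev GenLoops (n : ℕ) (X : Type*) [TopologicalSpace X] (x : X) :=
  {p : C((Fin n → I), X) // ∀ y ∈ cubeBoundary n, p y = x}

/-- Homotopy rel boundary as a setoid on generalized loops. -/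
def genLoopSetoid (n : ℕ) (X : Type*) [TopologicalSpace X] (x : X) :
    Setoid (GenLoops n X x) where
  r p q := p.1.HomotopicRel q.1 (cubeBoundary n)
  iseqv := ⟨fun p => ContinuousMap.HomotopicRel.refl p.1,
    fun h => h.symm, fun h h' => h.trans h'⟩

/-- The `n`-th homotopy group (as a type) of `X` at `x`. -/
def HtpyGroup (n : ℕ) (X : Type*) [TopologicalSpace X] (x : X) :=
  Quotient (genLoopSetoid n X x)

/-- The map induced by a continuous map on homotopy groups. -/
def htpyGroupMap (n : ℕ) {X Y : Type*} [TopologicalSpace X] [TopologicalSpace Y]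
    (f : C(X, Y)) (x : X) : HtpyGroup n X x → HtpyGroup n Y (f x) :=
  Quotient.map (fun p => ⟨f.comp p.1, fun y hy => by
      simp [ContinuousMap.comp_apply, p.2 y hy]⟩)
    (fun p q h => h.map fun F => F.compContinuousMap f)

/-- The map induced by a continuous map on path components. -/
def pi0Map {X Y : Type*} [TopologicalSpace X] [TopologicalSpace Y] (f : C(X, Y)) :
    ZerothHomotopy X → ZerothHomotopy Y :=
  Quotient.map f fun _ _ h => ⟨h.somePath.map f.continuous⟩

/-- A weak homotopy equivalence: a continuous map inducing a bijection on path
components and isomorphisms on all homotopy groups at all basepoints. -/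
def IsWeakHomotopyEquiv {X Y : Type*} [TopologicalSpace X] [TopologicalSpace Y]
    (f : C(X, Y)) : Prop :=
  Function.Bijective (pi0Map f) ∧
    ∀ (n : ℕ) (x : X), Function.Bijective (htpyGroupMap (n + 1) f x)

/-! ### Induced maps and diagrammatic equivalences -/

/-- The map induced on generalized homotopy links by a stratified map. -/
def holinkCMap {P : Type*} {X Y : Type*} [TopologicalSpace X] [TopologicalSpace Y]
    (sX : X → P) (sY : Y → P) (w : C(X, Y)) (hw : ∀ x, sY (w x) = sX x)
    {m : ℕ} (Iflag : Fin (m + 1) → P) :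
    C(Holink sX Iflag, Holink sY Iflag) :=
  ⟨fun f => ⟨w.comp f.1, fun x => by simp [ContinuousMap.comp_apply, hw, f.2 x]⟩,
    Continuous.subtype_mk
      ((ContinuousMap.continuous_postcomp w).comp continuous_subtype_val) _⟩

/-- A stratified map is a diagrammatic equivalence if it induces weak homotopy
equivalences on all generalized homotopy links. -/
def IsDiagEquiv {P : Type*} [Preorder P] {X Y : Type*} [TopologicalSpace X] [TopologicalSpace Y]
    (sX : X → P) (sY : Y → P) (w : C(X, Y)) (hw : ∀ x, sY (w x) = sX x) : Prop :=
  ∀ (m : ℕ) (Iflag : Fin (m + 1) → P), StrictMono Iflag →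
    IsWeakHomotopyEquiv (holinkCMap sX sY w hw Iflag)

/-- The restriction of a stratified map to the `q`-stratum. -/
def stratumCMap {Q : Type*} {X Y : Type*} [TopologicalSpace X] [TopologicalSpace Y]
    (sX : X → Q) (sY : Y → Q) (w : C(X, Y)) (hw : ∀ x, sY (w x) = sX x) (q : Q) :
    C({x : X // sX x = q}, {y : Y // sY y = q}) :=
  ⟨fun x => ⟨w x.1, by rw [hw x.1]; exact x.2⟩,
    Continuous.subtype_mk (w.continuous.comp continuous_subtype_val)
      fun x => by show sY (w x.1) = q; rw [hw x.1]; exact x.2⟩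

/-- The map induced on stratified homotopy links by a stratified map. -/
def stratHolinkCMap {P : Type*} [Preorder P] {X Y : Type*} [TopologicalSpace X]
    [TopologicalSpace Y] {sX : X → P} {sY : Y → P} (w : C(X, Y))
    (hw : ∀ x, sY (w x) = sX x) (p : P) :
    C(StratHolink sX p, StratHolink sY p) :=
  ⟨fun γ => ⟨w.comp γ.1,
      by simpa [ContinuousMap.comp_apply, hw] using γ.2.1,
      fun t ht => by simpa [ContinuousMap.comp_apply, hw] using γ.2.2.1 t ht,
      fun t t' ht ht' => by simpa [ContinuousMap.comp_apply, hw] using γ.2.2.2 t t' ht ht'⟩,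
    Continuous.subtype_mk
      ((ContinuousMap.continuous_postcomp w).comp continuous_subtype_val) _⟩

lemma stratHolinkCMap_strat {P : Type*} [Preorder P] {X Y : Type*} [TopologicalSpace X]
    [TopologicalSpace Y] {sX : X → P} {sY : Y → P} (w : C(X, Y))
    (hw : ∀ x, sY (w x) = sX x) (p : P) (γ : StratHolink sX p) :
    stratHolinkStrat sY p (stratHolinkCMap w hw p γ) = stratHolinkStrat sX p γ :=
  Subtype.ext (hw _)

/-- The local homotopy link of `X` at `x ∈ X_p`: the fiber of the stratified homotopy
link over `x`. -/
abbrev LocalHolink {P : Type*} [Preorder P] {X : Type*} [TopologicalSpace X]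
    (s : X → P) (p : P) (x : X) :=
  {γ : StratHolink s p // (γ.1 : C(I, X)) 0 = x}

/-- The stratification of the local homotopy link over `P_{>p}`. -/
def localHolinkStrat {P : Type*} [Preorder P] {X : Type*} [TopologicalSpace X]
    (s : X → P) (p : P) (x : X) (γ : LocalHolink s p x) : {q : P // p < q} :=
  stratHolinkStrat s p γ.1

/-- The map induced on local homotopy links by a stratified map. -/
def localHolinkCMap {P : Type*} [Preorder P] {X Y : Type*} [TopologicalSpace X]
    [TopologicalSpace Y] {sX : X → P} {sY : Y → P} (w : C(X, Y))
    (hw : ∀ x, sY (w x) = sX x) (p : P) (x : X) :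
    C(LocalHolink sX p x, LocalHolink sY p (w x)) :=
  ⟨fun γ => ⟨stratHolinkCMap w hw p γ.1, by
      show (w.comp γ.1.1) 0 = w x
      simp [ContinuousMap.comp_apply, γ.2]⟩,
    Continuous.subtype_mk
      ((stratHolinkCMap w hw p).continuous.comp continuous_subtype_val)
      fun γ => by
        show (w.comp γ.1.1) 0 = w x
        simp [ContinuousMap.comp_apply, γ.2]⟩

lemma localHolinkCMap_strat {P : Type*} [Preorder P] {X Y : Type*} [TopologicalSpace X]
    [TopologicalSpace Y] {sX : X → P} {sY : Y → P} (w : C(X, Y))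
    (hw : ∀ x, sY (w x) = sX x) (p : P) (x : X) (γ : LocalHolink sX p x) :
    localHolinkStrat sY p (w x) (localHolinkCMap w hw p x γ) = localHolinkStrat sX p x γ :=
  Subtype.ext (hw _)

end

/-- The element `2^{-(i+1)}` of the unit interval. -/
noncomputable def halfPow (i : ℕ) : I :=
  ⟨(1 / 2 : ℝ) ^ (i + 1), ⟨by positivity, by
    apply pow_le_one₀ <;> norm_num⟩⟩

lemma maxSupp_eq_iff {n : ℕ} {x : stdSimplex ℝ (Fin (n + 1))} {k : Fin (n + 1)} :
    maxSupp x = k ↔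
      0 < (x : Fin (n + 1) → ℝ) k ∧ ∀ j, k < j → (x : Fin (n + 1) → ℝ) j = 0 := by
  unfold maxSupp
  rw [Finset.max'_eq_iff]
  simp only [Finset.mem_filter, Finset.mem_univ, true_and]
  refine and_congr_right fun _ => forall_congr' fun j => ?_
  have hj : 0 ≤ (x : Fin (n + 1) → ℝ) j := x.2.1 j
  refine ⟨fun h hkj => ?_, fun h h0 => not_lt.1 fun hkj => h0.ne' (h hkj)⟩
  by_contra hne
  exact (h (hj.lt_of_ne' hne)).not_gt hkj

lemma maxSupp_le_iff {n : ℕ} {x : stdSimplex ℝ (Fin (n + 1))} {k : Fin (n + 1)} :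
    maxSupp x ≤ k ↔ ∀ j, k < j → (x : Fin (n + 1) → ℝ) j = 0 := by
  have hx := (maxSupp_eq_iff (x := x)).1 rfl
  refine ⟨fun h j hj => hx.2 j (h.trans_lt hj), fun h => ?_⟩
  by_contra! hlt
  exact hx.1.ne' (h _ hlt)

/-- The piecewise linear function vanishing for `t ≤ 2^{-m}` and equal to `1` for
`2^{1-m} ≤ t`. -/
noncomputable def dyadicRamp (m : ℕ) (t : ℝ) : ℝ := max 0 (min 1 (2 ^ m * t - 1))

/-- The hat function on `[0,1]` with peak at `2^{-i}` and supported in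
`[2^{-(i+1)}, 2^{1-i}]`. -/
noncomputable def dyadicHat (i : ℕ) (t : ℝ) : ℝ := dyadicRamp (i + 1) t - dyadicRamp i t

lemma continuous_dyadicHat (i : ℕ) : Continuous (dyadicHat i) := by
  unfold dyadicHat dyadicRamp
  fun_prop

lemma dyadicRamp_nonneg (m : ℕ) (t : ℝ) : 0 ≤ dyadicRamp m t := le_max_left _ _

lemma dyadicRamp_le_one (m : ℕ) (t : ℝ) : dyadicRamp m t ≤ 1 :=
  max_le zero_le_one (min_le_left _ _)

lemma dyadicRamp_eq_zero {m : ℕ} {t : ℝ} (h : 2 ^ m * t ≤ 1) : dyadicRamp m t = 0 :=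
  max_eq_left ((min_le_right _ _).trans (by linarith))

lemma dyadicRamp_eq_one {m : ℕ} {t : ℝ} (h : 2 ≤ 2 ^ m * t) : dyadicRamp m t = 1 := by
  unfold dyadicRamp
  rw [min_eq_left (by linarith), max_eq_right zero_le_one]

lemma dyadicHat_nonneg (i : ℕ) {t : ℝ} (ht : 0 ≤ t) : 0 ≤ dyadicHat i t := by
  unfold dyadicHat dyadicRamp
  rw [sub_nonneg]
  gcongr
  · norm_num
  · omega

lemma dyadicHat_le_one (i : ℕ) (t : ℝ) : dyadicHat i t ≤ 1 := by
  have h1 := dyadicRamp_nonneg i t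
  have h2 := dyadicRamp_le_one (i + 1) t
  unfold dyadicHat
  linarith

lemma dyadicHat_zero_right (i : ℕ) : dyadicHat i 0 = 0 := by
  simp [dyadicHat, dyadicRamp]

lemma hasSum_dyadicHat {t : ℝ} (h0 : 0 < t) (h1 : t ≤ 1) :
    HasSum (fun i => dyadicHat i t) 1 := by
  rw [hasSum_iff_tendsto_nat_of_nonneg fun i => dyadicHat_nonneg i h0.le]
  refine tendsto_const_nhds.congr' ?_
  have h := (tendsto_pow_atTop_atTop_of_one_lt (one_lt_two (α := ℝ))).eventually_ge_atTop (2 / t)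
  filter_upwards [h] with N hN
  unfold dyadicHat
  rw [Finset.sum_range_sub (fun i => dyadicRamp i t), dyadicRamp_eq_one ((div_le_iff₀ h0).1 hN),
    dyadicRamp_eq_zero (by simpa using h1), sub_zero]

lemma dyadicHat_half_pow (i j : ℕ) :
    dyadicHat j ((1 / 2) ^ i) = if j = i then 1 else 0 := by
  have key (m : ℕ) : dyadicRamp m ((1 / 2) ^ i) = if i < m then 1 else 0 := by
    split_ifs with h
    · apply dyadicRamp_eq_one
      obtain ⟨d, rfl⟩ := Nat.exists_eq_add_of_le (Nat.succ_le_of_lt h)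
      have : (1 : ℝ) ≤ 2 ^ d := one_le_pow₀ one_le_two
      rw [one_div, inv_pow, Nat.succ_eq_add_one, pow_add, pow_add]
      field_simp
      linarith
    · apply dyadicRamp_eq_zero
      rw [one_div, inv_pow, ← div_eq_mul_inv, div_le_one (by positivity)]
      exact pow_le_pow_right₀ one_le_two (not_lt.1 h)
  unfold dyadicHat
  rw [key, key]
  split_ifs <;> first | omega | norm_num

/-- A sequence in a single stratum of the simplex converging geometrically to `xbar` is
threaded, together with `xbar`, by an exit path. -/
lemma exists_exitPath_of_dist_le {n : ℕ} {k : Fin (n + 1)}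
    {y : ℕ → stdSimplex ℝ (Fin (n + 1))} {xbar : stdSimplex ℝ (Fin (n + 1))}
    (hk : ∀ i, maxSupp (y i) = k) (hd : ∀ i, dist (y i) xbar ≤ (1 / 2) ^ i) :
    ∃ γ : C(I, stdSimplex ℝ (Fin (n + 1))),
      IsExitPath (fun y => maxSupp y) γ ∧ γ 0 = xbar ∧
        ∀ i : ℕ, γ (halfPow i) = y (i + 1) := by
  have hcoord (i j) : |(y i : Fin (n + 1) → ℝ) j - (xbar : Fin (n + 1) → ℝ) j| ≤ (1 / 2) ^ i :=
    (dist_le_pi_dist (y i : Fin (n + 1) → ℝ) xbar j).trans (hd i)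
  have hgeom : Summable fun i : ℕ => ((1 / 2 : ℝ)) ^ i := summable_geometric_two
  have hlim : Filter.Tendsto y Filter.atTop (nhds xbar) :=
    tendsto_iff_dist_tendsto_zero.2 (squeeze_zero (fun _ => dist_nonneg) hd
      hgeom.tendsto_atTop_zero)
  have hxk : maxSupp xbar ≤ k := by
    refine maxSupp_le_iff.2 fun j hj => ?_
    have h1 : Filter.Tendsto (fun i => (y i : Fin (n + 1) → ℝ) j) Filter.atTop
        (nhds ((xbar : Fin (n + 1) → ℝ) j)) :=
      (((continuous_apply j).comp continuous_subtype_val).tendsto xbar).comp hlim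
    have h2 (i) : (y i : Fin (n + 1) → ℝ) j = 0 := (maxSupp_eq_iff.1 (hk i)).2 j hj
    simp only [h2] at h1
    exact (tendsto_nhds_unique h1 tendsto_const_nhds)
  let g (t : I) (j : Fin (n + 1)) : ℝ := (xbar : Fin (n + 1) → ℝ) j +
    ∑' i, dyadicHat i t * ((y i : Fin (n + 1) → ℝ) j - (xbar : Fin (n + 1) → ℝ) j)
  have hbound (i j) (t : I) :
      ‖dyadicHat i t * ((y i : Fin (n + 1) → ℝ) j - (xbar : Fin (n + 1) → ℝ) j)‖ ≤
        (1 / 2) ^ i := by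
    rw [norm_mul, Real.norm_of_nonneg (dyadicHat_nonneg i t.2.1)]
    exact (mul_le_of_le_one_left (norm_nonneg _) (dyadicHat_le_one i t)).trans (hcoord i j)
  have hsum (j) (t : I) : Summable fun i =>
      dyadicHat i t * ((y i : Fin (n + 1) → ℝ) j - (xbar : Fin (n + 1) → ℝ) j) :=
    hgeom.of_norm_bounded fun i => hbound i j t
  have hcont : Continuous g := by
    refine continuous_pi fun j => continuous_const.add ?_
    exact continuous_tsum (fun i => ((continuous_dyadicHat i).comp continuous_subtype_val).mul
      continuous_const) hgeom fun i t => hbound i j t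
  have hg0 : g 0 = xbar := by
    funext j
    simp [g, dyadicHat_zero_right]
  have hgpos (t : I) (ht : t ≠ 0) (j) :
      HasSum (fun i => dyadicHat i t * (y i : Fin (n + 1) → ℝ) j) (g t j) := by
    have h1 := hasSum_dyadicHat (unitInterval.pos_iff_ne_zero.2 ht) t.2.2
    have h2 := (h1.mul_right ((xbar : Fin (n + 1) → ℝ) j)).add (hsum j t).hasSum
    rw [one_mul] at h2
    exact h2.congr_fun fun i => by ring
  have hmem (t : I) : g t ∈ stdSimplex ℝ (Fin (n + 1)) := by
    rcases eq_or_ne t 0 with rfl | ht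
    · rw [hg0]
      exact xbar.2
    refine ⟨fun j => (hgpos t ht j).nonneg fun i =>
      mul_nonneg (dyadicHat_nonneg i t.2.1) ((y i).2.1 j), ?_⟩
    have h1 := hasSum_sum (s := Finset.univ) fun j _ => hgpos t ht j
    simp only [← Finset.mul_sum] at h1
    have h2 := hasSum_dyadicHat (unitInterval.pos_iff_ne_zero.2 ht) t.2.2
    refine h1.unique (h2.congr_fun fun i => ?_)
    exact (congrArg (dyadicHat i t * ·) (y i).2.2).trans (mul_one _)
  have hstrat (t : I) (ht : t ≠ 0) : maxSupp ⟨g t, hmem t⟩ = k := by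
    refine maxSupp_eq_iff.2 ⟨?_, fun j hj => ?_⟩
    · have h1 := hasSum_dyadicHat (unitInterval.pos_iff_ne_zero.2 ht) t.2.2
      obtain ⟨i, hi⟩ : ∃ i, dyadicHat i t ≠ 0 := by
        by_contra! h
        simp only [h] at h1
        exact zero_ne_one (hasSum_zero.unique h1)
      have hi' := (dyadicHat_nonneg i t.2.1).lt_of_ne' hi
      refine (mul_pos hi' (maxSupp_eq_iff.1 (hk i)).1).trans_le
        (le_hasSum (hgpos t ht k) i fun i' _ => ?_)
      exact mul_nonneg (dyadicHat_nonneg i' t.2.1) ((y i').2.1 k)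
    · refine (hgpos t ht j).unique ?_
      simp [(maxSupp_eq_iff.1 (hk _)).2 j hj, hasSum_zero]
  refine ⟨⟨fun t => ⟨g t, hmem t⟩, hcont.subtype_mk hmem⟩, ⟨?_, ?_⟩, Subtype.ext hg0, ?_⟩
  · intro t t' ht ht'
    exact (hstrat t ht).trans (hstrat t' ht').symm
  · intro t
    rcases eq_or_ne t 0 with rfl | ht
    · exact le_rfl
    · have h0 : (⟨g 0, hmem 0⟩ : stdSimplex ℝ (Fin (n + 1))) = xbar := Subtype.ext hg0
      change maxSupp ⟨g 0, hmem 0⟩ ≤ maxSupp ⟨g t, hmem t⟩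
      rw [h0, hstrat t ht]
      exact hxk
  · intro i
    refine Subtype.ext (funext fun j => ?_)
    have hne : halfPow i ≠ 0 := fun h =>
      (pow_pos (one_half_pos (α := ℝ)) (i + 1)).ne' (congrArg Subtype.val h)
    refine (hgpos _ hne j).unique ?_
    have h1 (m) : dyadicHat m (halfPow i) = if m = i + 1 then 1 else 0 :=
      dyadicHat_half_pow (i + 1) m
    have h2 := hasSum_single (f := fun m => dyadicHat m (halfPow i) *
      (y m : Fin (n + 1) → ℝ) j) (i + 1) fun m hm => by simp [h1, hm]
    simp only [h1, if_true, one_mul] at h2 ⊢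
    exact h2

lemma exists_subseq_exitPath {n : ℕ} {x : ℕ → stdSimplex ℝ (Fin (n + 1))}
    {xbar : stdSimplex ℝ (Fin (n + 1))} (hx : Filter.Tendsto x Filter.atTop (nhds xbar)) :
    ∃ φ : ℕ → ℕ, StrictMono φ ∧
      ∃ γ : C(I, stdSimplex ℝ (Fin (n + 1))),
        IsExitPath (fun y => maxSupp y) γ ∧ γ 0 = xbar ∧
          ∀ i : ℕ, γ (halfPow i) = x (φ i) := by
  obtain ⟨k, hk⟩ := Finite.exists_infinite_fiber fun i => maxSupp (x i)
  have hfreq : ∃ᶠ m in Filter.atTop, maxSupp (x m) = k :=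
    Nat.frequently_atTop_iff_infinite.2 (Set.infinite_coe_iff.1 hk)
  obtain ⟨φ, hφ, h⟩ := Filter.extraction_forall_of_frequently fun i : ℕ =>
    hfreq.and_eventually (hx.eventually
      (Metric.closedBall_mem_nhds xbar (pow_pos (one_half_pos (α := ℝ)) i)))
  obtain ⟨γ, hγ, h0, hi⟩ :=
    exists_exitPath_of_dist_le (y := x ∘ φ) (fun i => (h i).1) fun i => (h i).2
  exact ⟨fun i => φ (i + 1), fun a b hab => hφ (Nat.succ_lt_succ hab), γ, hγ, h0, hi⟩

lemma tendsto_halfPow : Filter.Tendsto halfPow Filter.atTop (nhds 0) := by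
  rw [tendsto_subtype_rng]
  exact (tendsto_pow_atTop_nhds_zero_of_lt_one (by norm_num) (by norm_num)).comp
    (Filter.tendsto_add_atTop_nat 1)

/-- The realized stratified standard simplex carries the final topology with respect
to its exit paths; moreover every convergent sequence admits a subsequence threaded,
together with its limit, by a single exit path. -/
theorem stdSimplex_final_topology_exit_paths (n : ℕ) :
    (∀ U : Set (stdSimplex ℝ (Fin (n + 1))),
      IsOpen U ↔ ∀ γ : C(I, stdSimplex ℝ (Fin (n + 1))),
        IsExitPath (fun x => maxSupp x) γ → IsOpen ((γ : I → stdSimplex ℝ (Fin (n + 1))) ⁻¹' U)) ∧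
    ∀ (x : ℕ → stdSimplex ℝ (Fin (n + 1))) (xbar : stdSimplex ℝ (Fin (n + 1))),
      Filter.Tendsto x Filter.atTop (nhds xbar) →
      ∃ φ : ℕ → ℕ, StrictMono φ ∧
        ∃ γ : C(I, stdSimplex ℝ (Fin (n + 1))),
          IsExitPath (fun y => maxSupp y) γ ∧ γ 0 = xbar ∧
            ∀ i : ℕ, γ (halfPow i) = x (φ i) := by
  refine ⟨fun U => ⟨fun hU γ _ => hU.preimage γ.continuous, fun h => ?_⟩,
    fun x xbar hx => exists_subseq_exitPath hx⟩
  rw [← isClosed_compl_iff, ← isSeqClosed_iff_isClosed]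
  intro x xbar hxU hx hbar
  obtain ⟨φ, -, γ, hγ, h0, hi⟩ := exists_subseq_exitPath hx
  have hnhds : γ ⁻¹' U ∈ nhds (0 : I) := (h γ hγ).mem_nhds (by rwa [Set.mem_preimage, h0])
  obtain ⟨i, hiU⟩ := (tendsto_halfPow.eventually hnhds).exists
  exact hxU (φ i) (hi i ▸ hiU)
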